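/- Let α ∈ (0,1). Let F : ℝ² → ℝ have finite parabolic Hölder seminorm [F]_α, and let G : ℝ² → ℝ be twice differentiable in x₁ away from {x₂ = 0} with |∂₁²G(x)| ≤ C(G)·(|x₂|^{(α−2)/2} + |x₂|^{(2α−2)/2}) for all x with x₂ ≠ 0, for some constant C(G). Then the product F·∂₁²G is locally integrable, and there is a constant C(α) such that for all T ∈ (0,1] and all x ∈ ℝ²: |∫_{ℝ²} (F(x) − F(y)) · ψ_T(x − y) · ∂₁²G(y) dy| ≤ C(α) · C(G) · [F]_α · T^{(2α−2)/4}. (In the paper's notation, this is the commutator estimate ‖[F, (·)_T] ∂₁²G‖ ≲ C(G)[F]_α·T^{(2α−2)/4}.) -/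

import Mathlib

open MeasureTheory

/-- The parabolic distance on `ℝ²`. -/
noncomputable def pdist (x y : ℝ × ℝ) : ℝ := |x.1 - y.1| + Real.sqrt |x.2 - y.2|

/-- Partial derivative in the first (space-like) variable. -/
noncomputable def pd1 (f : ℝ × ℝ → ℝ) : ℝ × ℝ → ℝ := fun x => deriv (fun s => f (s, x.2)) x.1

/-- Partial derivative in the second (time-like) variable. -/
noncomputable def pd2 (f : ℝ × ℝ → ℝ) : ℝ × ℝ → ℝ := fun x => deriv (fun s => f (x.1, s)) x.2

def IsPsiKernel (ψ : ℝ → ℝ × ℝ → ℝ) : Prop :=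
  (∀ T : ℝ, 0 < T → ∃ φ : SchwartzMap (ℝ × ℝ) ℝ, ψ T = ⇑φ) ∧
  (∃ C : ℝ, ∀ T : ℝ, 0 < T → ∀ k : ℝ × ℝ,
      (∫ x : ℝ × ℝ,
          Complex.exp (-(2 * Real.pi * (k.1 * x.1 + k.2 * x.2) : ℝ) * Complex.I) * (ψ T x : ℂ))
        = (C : ℂ) * Complex.exp ((-(T * (k.1 ^ 4 + k.2 ^ 2)) : ℝ) : ℂ)) ∧
  (∫ x : ℝ × ℝ, |ψ 1 x|) = 1

lemma eq_zero_of_integral_exp_eq_zero {h : ℝ × ℝ → ℂ} (hc : Continuous h) (hi : Integrable h)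
    (h0 : ∀ k : ℝ × ℝ, (∫ x : ℝ × ℝ,
      Complex.exp (-(2 * Real.pi * (k.1 * x.1 + k.2 * x.2) : ℝ) * Complex.I) * h x) = 0) :
    h = 0 := by
  have hmp := WithLp.volume_preserving_ofLp ℝ ℝ
  have hemb : MeasurableEmbedding (@WithLp.ofLp 2 (ℝ × ℝ)) :=
    (MeasurableEquiv.toLp 2 (ℝ × ℝ)).symm.measurableEmbedding
  let g : WithLp 2 (ℝ × ℝ) → ℂ := fun v => h v.ofLp
  have hgc : Continuous g := hc.comp (WithLp.prod_continuous_ofLp 2 ℝ ℝ)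
  have hgi : Integrable g := (hmp.integrable_comp_emb hemb).2 hi
  have hF : FourierTransform.fourier g = 0 := by
    ext w
    rw [Real.fourier_eq', Pi.zero_apply, ← h0 w.ofLp, ← hmp.integral_comp hemb]
    refine integral_congr_ae (Filter.Eventually.of_forall fun v => ?_)
    simp only [WithLp.prod_inner_apply, smul_eq_mul, g]
    congr 3
    simp
  have hinv := hgc.fourierInv_fourier_eq hgi (by rw [hF]; exact integrable_zero _ _ _)
  rw [hF] at hinv
  have hg0 : g = 0 := by
    rw [← hinv]
    ext v
    rw [Real.fourierInv_eq]
    simp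
  ext x
  exact congrFun hg0 (WithLp.toLp 2 x)

lemma map_prodMap_mul_volume {a b : ℝ} (ha : 0 < a) (hb : 0 < b) :
    Measure.map (Prod.map (a * ·) (b * ·)) (volume : Measure (ℝ × ℝ))
      = ENNReal.ofReal (a * b)⁻¹ • (volume : Measure (ℝ × ℝ)) := by
  rw [Measure.volume_eq_prod, ← Measure.map_prod_map _ _ (measurable_const_mul a)
    (measurable_const_mul b), Real.map_volume_mul_left ha.ne', Real.map_volume_mul_left hb.ne',
    Measure.prod_smul_left, Measure.prod_smul_right, smul_smul,
    ← ENNReal.ofReal_mul (abs_nonneg _), abs_of_pos (inv_pos.2 ha), abs_of_pos (inv_pos.2 hb),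
    mul_inv]

lemma measurableEmbedding_prodMap_mul {a b : ℝ} (ha : 0 < a) (hb : 0 < b) :
    MeasurableEmbedding (Prod.map (a * ·) (b * ·) : ℝ × ℝ → ℝ × ℝ) :=
  ((Homeomorph.mulLeft₀ a ha.ne').prodCongr (Homeomorph.mulLeft₀ b hb.ne')).measurableEmbedding

lemma integral_comp_prodMap_mul {E : Type*} [NormedAddCommGroup E] [NormedSpace ℝ E] {a b : ℝ}
    (ha : 0 < a) (hb : 0 < b) (f : ℝ × ℝ → E) :
    ∫ w : ℝ × ℝ, f (a * w.1, b * w.2) = (a * b)⁻¹ • ∫ y : ℝ × ℝ, f y := by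
  have h := (measurableEmbedding_prodMap_mul ha hb).integral_map (μ := volume) f
  rw [map_prodMap_mul_volume ha hb, integral_smul_measure,
    ENNReal.toReal_ofReal (by positivity)] at h
  exact h.symm

lemma integrable_comp_prodMap_mul {E : Type*} [NormedAddCommGroup E] {a b : ℝ}
    (ha : 0 < a) (hb : 0 < b) {f : ℝ × ℝ → E} (hf : Integrable f) :
    Integrable fun w : ℝ × ℝ => f (a * w.1, b * w.2) := by
  have h := (measurableEmbedding_prodMap_mul ha hb).integrable_map_iff (μ := volume) (g := f)
  rw [map_prodMap_mul_volume ha hb] at h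
  exact h.1 (hf.smul_measure ENNReal.ofReal_ne_top)

lemma IsPsiKernel.comp_mul {ψ : ℝ → ℝ × ℝ → ℝ} (hψ : IsPsiKernel ψ) {a : ℝ} (ha : 0 < a)
    (w : ℝ × ℝ) : ψ (a ^ 4) (a * w.1, a ^ 2 * w.2) = (a * a ^ 2)⁻¹ * ψ 1 w := by
  obtain ⟨hS, ⟨C, hC⟩, -⟩ := hψ
  obtain ⟨φ, hφ⟩ := hS (a ^ 4) (by positivity)
  obtain ⟨φ₁, hφ₁⟩ := hS 1 one_pos
  have ha2 : 0 < a ^ 2 := by positivity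
  have hi : Integrable fun x => (ψ (a ^ 4) x : ℂ) := by
    rw [hφ]; exact φ.integrable.ofReal
  have hi₁ : Integrable fun x => (ψ 1 x : ℂ) := by
    rw [hφ₁]; exact φ₁.integrable.ofReal
  have hc : Continuous (ψ (a ^ 4)) := by rw [hφ]; exact φ.continuous
  have hc₁ : Continuous (ψ 1) := by rw [hφ₁]; exact φ₁.continuous
  have hexp : ∀ k : ℝ × ℝ, Continuous fun x : ℝ × ℝ =>
      Complex.exp (-(2 * Real.pi * (k.1 * x.1 + k.2 * x.2) : ℝ) * Complex.I) := by
    intro k; fun_prop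
  have hprod : ∀ (k : ℝ × ℝ) (f : ℝ × ℝ → ℂ), Integrable f → Integrable fun x : ℝ × ℝ =>
      Complex.exp (-(2 * Real.pi * (k.1 * x.1 + k.2 * x.2) : ℝ) * Complex.I) * f x := by
    intro k f hf
    refine hf.bdd_mul (c := 1) (hexp k).aestronglyMeasurable
      (Filter.Eventually.of_forall fun x => ?_)
    rw [← Complex.ofReal_neg, Complex.norm_exp_ofReal_mul_I]
  have hi2 := integrable_comp_prodMap_mul ha ha2 hi
  have key := eq_zero_of_integral_exp_eq_zero
    (h := fun w : ℝ × ℝ => (ψ (a ^ 4) (a * w.1, a ^ 2 * w.2) : ℂ)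
      - ((a * a ^ 2)⁻¹ : ℝ) * (ψ 1 w : ℂ)) (by fun_prop) (hi2.sub (hi₁.const_mul _)) ?_
  · have := congrFun key w
    simp only [Pi.zero_apply, sub_eq_zero] at this
    exact_mod_cast this
  · intro k
    simp only [mul_sub]
    rw [integral_sub (hprod k _ hi2) (hprod k _ (hi₁.const_mul _))]
    simp only [mul_left_comm (Complex.exp _)]
    rw [integral_const_mul, hC 1 one_pos k]
    have h1 := integral_comp_prodMap_mul ha ha2 (fun y : ℝ × ℝ =>
      Complex.exp (-(2 * Real.pi * (k.1 / a * y.1 + k.2 / a ^ 2 * y.2) : ℝ) * Complex.I)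
        * (ψ (a ^ 4) y : ℂ))
    rw [hC (a ^ 4) (by positivity) (k.1 / a, k.2 / a ^ 2)] at h1
    have e1 : ∀ w : ℝ × ℝ, k.1 / a * (a * w.1) + k.2 / a ^ 2 * (a ^ 2 * w.2)
        = k.1 * w.1 + k.2 * w.2 := by
      intro w; field_simp
    have e2 : a ^ 4 * ((k.1 / a) ^ 4 + (k.2 / a ^ 2) ^ 2) = 1 * (k.1 ^ 4 + k.2 ^ 2) := by
      field_simp
    simp only [e1, e2] at h1
    rw [h1, Complex.real_smul, sub_self]

lemma integrableOn_abs_rpow {p : ℝ} (hp : -1 < p) (r : ℝ) :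
    IntegrableOn (fun s : ℝ => |s| ^ p) (Set.Icc (-r) r) := by
  rcases lt_or_ge r 0 with hr | hr
  · rw [Set.Icc_eq_empty (by linarith)]; exact integrableOn_empty
  have h1 : IntervalIntegrable (fun s : ℝ => |s| ^ p) volume 0 r := by
    refine (intervalIntegral.intervalIntegrable_rpow' hp).congr fun s hs => ?_
    rw [Set.uIoc_of_le hr] at hs
    simp only [abs_of_pos hs.1]
  have h2 : IntervalIntegrable (fun s : ℝ => |s| ^ p) volume (-r) 0 := by
    have := ((IntervalIntegrable.iff_comp_neg (by simp)).1 h1).symm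
    simpa using this
  exact (intervalIntegrable_iff_integrableOn_Icc_of_le (by linarith)).1 (h2.trans h1)

lemma locallyIntegrable_abs_snd_rpow {p : ℝ} (hp : -1 < p) :
    LocallyIntegrable (fun x : ℝ × ℝ => |x.2| ^ p) := by
  rw [locallyIntegrable_iff]
  intro K hK
  obtain ⟨r, hr⟩ := hK.isBounded.subset_closedBall (0 : ℝ × ℝ)
  have hsub : K ⊆ Set.Icc (-r) r ×ˢ Set.Icc (-r) r := by
    refine hr.trans ?_
    rw [Prod.zero_eq_mk, ← closedBall_prod_same, Real.closedBall_eq_Icc, zero_sub, zero_add]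
  refine IntegrableOn.mono_set ?_ hsub
  have h1 : IntegrableOn (fun _ : ℝ => (1 : ℝ)) (Set.Icc (-r) r) :=
    integrableOn_const (by simp)
  have := Integrable.mul_prod h1 (integrableOn_abs_rpow hp r)
  rw [Measure.prod_restrict] at this
  simpa [IntegrableOn, Measure.volume_eq_prod] using this

lemma exists_integral_inv_one_add_sq_mul_abs_rpow_le {p : ℝ} (hp : -1 < p) (hp0 : p ≤ 0) :
    ∃ M : ℝ, ∀ c : ℝ, Integrable (fun s : ℝ => (1 + (c - s) ^ 2)⁻¹ * |s| ^ p) ∧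
      ∫ s : ℝ, (1 + (c - s) ^ 2)⁻¹ * |s| ^ p ≤ M := by
  refine ⟨(∫ s in Set.Icc (-1 : ℝ) 1, |s| ^ p) + Real.pi, fun c => ?_⟩
  have hind : Integrable ((Set.Icc (-1 : ℝ) 1).indicator fun s => |s| ^ p) :=
    (integrable_indicator_iff measurableSet_Icc).2 (integrableOn_abs_rpow hp 1)
  have hcau : Integrable fun s : ℝ => (1 + (c - s) ^ 2)⁻¹ :=
    integrable_inv_one_add_sq.comp_sub_left c
  have hle : ∀ s : ℝ, (1 + (c - s) ^ 2)⁻¹ * |s| ^ p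
      ≤ (Set.Icc (-1 : ℝ) 1).indicator (fun s => |s| ^ p) s + (1 + (c - s) ^ 2)⁻¹ := by
    intro s
    have hpos : 0 ≤ |s| ^ p := by positivity
    have hinv : 0 ≤ (1 + (c - s) ^ 2)⁻¹ := by positivity
    by_cases hs : s ∈ Set.Icc (-1 : ℝ) 1
    · rw [Set.indicator_of_mem hs]
      have : (1 + (c - s) ^ 2)⁻¹ ≤ 1 := inv_le_one_of_one_le₀ (by nlinarith [sq_nonneg (c - s)])
      nlinarith
    · rw [Set.indicator_of_notMem hs]
      have h1 : 1 ≤ |s| := by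
        by_contra! h
        exact hs (abs_le.1 h.le)
      have := Real.rpow_le_one_of_one_le_of_nonpos h1 hp0
      nlinarith
  have hprod : Integrable (fun s : ℝ => (1 + (c - s) ^ 2)⁻¹ * |s| ^ p) := by
    refine (hind.add hcau).mono' (by fun_prop) (Filter.Eventually.of_forall fun s => ?_)
    rw [Real.norm_of_nonneg (by positivity)]
    exact hle s
  refine ⟨hprod, (integral_mono hprod (hind.add hcau) hle).trans_eq ?_⟩
  simp only [Pi.add_apply]
  rw [integral_add hind hcau, integral_indicator measurableSet_Icc,
    integral_sub_left_eq_self (fun s : ℝ => (1 + s ^ 2)⁻¹), integral_univ_inv_one_add_sq]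

lemma pdist_nonneg (x y : ℝ × ℝ) : 0 ≤ pdist x y := by
  unfold pdist; positivity

lemma continuous_of_abs_sub_le_pdist_rpow {F : ℝ × ℝ → ℝ} {A α : ℝ} (hα : 0 < α)
    (hF : ∀ x y : ℝ × ℝ, |F x - F y| ≤ A * pdist x y ^ α) : Continuous F := by
  rw [continuous_iff_continuousAt]
  intro x
  rw [ContinuousAt, tendsto_iff_dist_tendsto_zero]
  have hc : Continuous fun y : ℝ × ℝ => A * pdist y x ^ α := by
    unfold pdist
    exact continuous_const.mul (Continuous.rpow_const (by fun_prop) fun _ => Or.inr hα.le)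
  have h0 := hc.tendsto x
  have hx : A * pdist x x ^ α = 0 := by simp [pdist, Real.zero_rpow hα.ne']
  rw [hx] at h0
  exact squeeze_zero (fun _ => dist_nonneg) (fun y => hF y x) h0

lemma exists_pdist_rpow_mul_abs_schwartz_le (φ : SchwartzMap (ℝ × ℝ) ℝ) {α : ℝ} (hα : 0 ≤ α)
    (hα1 : α ≤ 1) : ∃ K : ℝ, 0 ≤ K ∧ ∀ w : ℝ × ℝ, pdist w 0 ^ α * |φ w|
      ≤ K * ((1 + w.1 ^ 2)⁻¹ * (1 + w.2 ^ 2)⁻¹) := by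
  set B := 2 ^ 5 * (Finset.Iic ((5 : ℕ), (0 : ℕ))).sup
    (fun m => SchwartzMap.seminorm ℝ m.1 m.2) φ
  have hbd : ∀ w, (1 + ‖w‖) ^ 5 * |φ w| ≤ B := fun w => by
    simpa using SchwartzMap.one_add_le_sup_seminorm_apply (𝕜 := ℝ) (m := (5, 0)) (k := 5) (n := 0)
      le_rfl le_rfl φ w
  have hB0 : 0 ≤ B := le_trans (by positivity) (hbd 0)
  refine ⟨3 * B, by positivity, fun w => ?_⟩
  have h1 : |w.1| ≤ ‖w‖ := norm_fst_le w
  have h2 : |w.2| ≤ ‖w‖ := norm_snd_le w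
  have hs : Real.sqrt |w.2| ≤ 1 + |w.2| := by
    rw [Real.sqrt_le_left (by positivity)]
    nlinarith [abs_nonneg w.2]
  have hp : pdist w 0 ≤ 3 * (1 + ‖w‖) - 1 := by
    simp only [pdist, Prod.fst_zero, Prod.snd_zero, sub_zero]
    linarith [norm_nonneg w]
  have hpa : pdist w 0 ^ α ≤ 3 * (1 + ‖w‖) := by
    have h3 : pdist w 0 ^ α ≤ (1 + pdist w 0) ^ α :=
      Real.rpow_le_rpow (pdist_nonneg _ _) (by linarith) hα
    have h4 : (1 + pdist w 0) ^ α ≤ (1 + pdist w 0) ^ (1 : ℝ) :=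
      Real.rpow_le_rpow_of_exponent_le (by linarith [pdist_nonneg w 0]) hα1
    rw [Real.rpow_one] at h4
    linarith
  have hq : ∀ t : ℝ, |t| ≤ ‖w‖ → 1 + t ^ 2 ≤ (1 + ‖w‖) ^ 2 := fun t ht => by
    rw [← sq_abs t]; nlinarith [abs_nonneg t, norm_nonneg w]
  rw [← mul_inv, ← div_eq_mul_inv, le_div_iff₀ (by positivity)]
  calc pdist w 0 ^ α * |φ w| * ((1 + w.1 ^ 2) * (1 + w.2 ^ 2))
      ≤ 3 * (1 + ‖w‖) * |φ w| * ((1 + ‖w‖) ^ 2 * (1 + ‖w‖) ^ 2) := by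
        gcongr
        · exact hq _ h1
        · exact hq _ h2
    _ = 3 * ((1 + ‖w‖) ^ 5 * |φ w|) := by ring
    _ ≤ 3 * B := by gcongr; exact hbd w

lemma pdist_mul_sq {a : ℝ} (ha : 0 < a) (x y : ℝ × ℝ) :
    pdist (a * x.1, a ^ 2 * x.2) (a * y.1, a ^ 2 * y.2) = a * pdist (x - y) 0 := by
  simp only [pdist, Prod.fst_sub, Prod.snd_sub, Prod.fst_zero, Prod.snd_zero, sub_zero,
    ← mul_sub, abs_mul, abs_of_pos ha, abs_of_pos (pow_pos ha 2)]
  rw [Real.sqrt_mul (by positivity), Real.sqrt_sq ha.le]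
  ring

lemma ae_snd_ne_zero : ∀ᵐ x : ℝ × ℝ, x.2 ≠ 0 := by
  have h := Measure.quasiMeasurePreserving_snd (μ := (volume : Measure ℝ))
    (ν := (volume : Measure ℝ))
  exact h.ae (Measure.ae_ne volume (0 : ℝ))

lemma locallyIntegrable_of_abs_le_abs_snd_rpow {g : ℝ × ℝ → ℝ} {p q c : ℝ} (hp : -1 < p)
    (hq : -1 < q) (hgm : Measurable g)
    (hg : ∀ x : ℝ × ℝ, x.2 ≠ 0 → |g x| ≤ c * (|x.2| ^ p + |x.2| ^ q)) :
    LocallyIntegrable g := by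
  have h : LocallyIntegrable fun x : ℝ × ℝ => c * (|x.2| ^ p + |x.2| ^ q) :=
    ((locallyIntegrable_abs_snd_rpow hp).add (locallyIntegrable_abs_snd_rpow hq)).continuous_mul
      continuous_const
  refine h.mono hgm.aestronglyMeasurable ?_
  filter_upwards [ae_snd_ne_zero] with x hx
  exact (hg x hx).trans (le_abs_self _)

lemma abs_integral_le_of_abs_le_inv_one_add_sq_mul {M₁ M₂ p q : ℝ}
    (hM₁ : ∀ c : ℝ, Integrable (fun s : ℝ => (1 + (c - s) ^ 2)⁻¹ * |s| ^ p) ∧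
      ∫ s : ℝ, (1 + (c - s) ^ 2)⁻¹ * |s| ^ p ≤ M₁)
    (hM₂ : ∀ c : ℝ, Integrable (fun s : ℝ => (1 + (c - s) ^ 2)⁻¹ * |s| ^ q) ∧
      ∫ s : ℝ, (1 + (c - s) ^ 2)⁻¹ * |s| ^ q ≤ M₂)
    {H : ℝ × ℝ → ℝ} {L : ℝ} (hL : 0 ≤ L) (ξ : ℝ × ℝ)
    (hH : ∀ w : ℝ × ℝ, w.2 ≠ 0 → |H w| ≤ L * ((1 + (ξ.1 - w.1) ^ 2)⁻¹ *
      ((1 + (ξ.2 - w.2) ^ 2)⁻¹ * |w.2| ^ p + (1 + (ξ.2 - w.2) ^ 2)⁻¹ * |w.2| ^ q))) :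
    |∫ w, H w| ≤ L * (Real.pi * (M₁ + M₂)) := by
  obtain ⟨i₁, b₁⟩ := hM₁ ξ.2
  obtain ⟨i₂, b₂⟩ := hM₂ ξ.2
  have i₀ : Integrable fun s : ℝ => (1 + (ξ.1 - s) ^ 2)⁻¹ :=
    integrable_inv_one_add_sq.comp_sub_left ξ.1
  have hi := (i₀.mul_prod (i₁.add i₂)).const_mul L
  rw [← Measure.volume_eq_prod] at hi
  rw [← Real.norm_eq_abs]
  refine (norm_integral_le_of_norm_le hi ?_).trans ?_
  · filter_upwards [ae_snd_ne_zero] with w hw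
    exact hH w hw
  · rw [integral_const_mul, Measure.volume_eq_prod,
      integral_prod_mul (fun s : ℝ => (1 + (ξ.1 - s) ^ 2)⁻¹),
      integral_sub_left_eq_self (fun s : ℝ => (1 + s ^ 2)⁻¹), integral_univ_inv_one_add_sq]
    simp only [Pi.add_apply]
    rw [integral_add i₁ i₂]
    gcongr

lemma rpow_mul_weight_le {a α s : ℝ} (ha : 0 < a) (ha1 : a ≤ 1) (hα : 0 ≤ α) :
    a ^ α * (|a ^ 2 * s| ^ ((α - 2) / 2) + |a ^ 2 * s| ^ ((2 * α - 2) / 2))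
      ≤ (a ^ 4) ^ ((2 * α - 2) / 4) * (|s| ^ ((α - 2) / 2) + |s| ^ ((2 * α - 2) / 2)) := by
  have e : ∀ (n : ℕ) (p : ℝ), (a ^ n) ^ p = a ^ (n * p) := fun n p => by
    rw [← Real.rpow_natCast, ← Real.rpow_mul ha.le]
  have h2 : ∀ p : ℝ, |a ^ 2 * s| ^ p = a ^ (2 * p) * |s| ^ p := fun p => by
    rw [abs_mul, abs_of_pos (pow_pos ha 2), Real.mul_rpow (by positivity) (abs_nonneg s), e]
    norm_num
  rw [h2, h2, e, mul_add, mul_add, ← mul_assoc, ← mul_assoc, ← Real.rpow_add ha,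
    ← Real.rpow_add ha]
  gcongr ?_ * _ + ?_ * _
  · exact (congrArg (a ^ ·) (by push_cast; ring)).le
  · refine Real.rpow_le_rpow_of_exponent_ge ha ha1 ?_
    push_cast
    linarith

/-- the classical product `F·∂₁²G` is well defined and
satisfies a `C^{2α-2}`-commutator estimate. -/
theorem classical_product_commutator_estimate
    (ψ : ℝ → ℝ × ℝ → ℝ) (hψ : IsPsiKernel ψ)
    (α : ℝ) (hα : 0 < α) (hα1 : α < 1) :
    ∃ C : ℝ, ∀ (F G : ℝ × ℝ → ℝ) (A CG : ℝ),
      (∀ x y : ℝ × ℝ, |F x - F y| ≤ A * pdist x y ^ α) →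
      (∀ x : ℝ × ℝ, x.2 ≠ 0 → DifferentiableAt ℝ (fun s : ℝ => G (s, x.2)) x.1) →
      (∀ x : ℝ × ℝ, x.2 ≠ 0 → DifferentiableAt ℝ (fun s : ℝ => pd1 G (s, x.2)) x.1) →
      Measurable (pd1 (pd1 G)) →
      (∀ x : ℝ × ℝ, x.2 ≠ 0 →
        |pd1 (pd1 G) x| ≤ CG * (|x.2| ^ ((α - 2) / 2) + |x.2| ^ ((2 * α - 2) / 2))) →
      LocallyIntegrable (fun x : ℝ × ℝ => F x * pd1 (pd1 G) x) volume ∧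
      ∀ T : ℝ, 0 < T → T ≤ 1 → ∀ x : ℝ × ℝ,
        |∫ y : ℝ × ℝ, (F x - F y) * ψ T (x - y) * pd1 (pd1 G) y|
          ≤ C * CG * A * T ^ ((2 * α - 2) / 4) := by
  obtain ⟨φ₁, hφ₁⟩ := hψ.1 1 one_pos
  obtain ⟨K, hK0, hK⟩ := exists_pdist_rpow_mul_abs_schwartz_le φ₁ hα.le hα1.le
  obtain ⟨M₁, hM₁⟩ := exists_integral_inv_one_add_sq_mul_abs_rpow_le (p := (α - 2) / 2)
    (by linarith) (by linarith)
  obtain ⟨M₂, hM₂⟩ := exists_integral_inv_one_add_sq_mul_abs_rpow_le (p := (2 * α - 2) / 2)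
    (by linarith) (by linarith)
  refine ⟨K * (Real.pi * (M₁ + M₂)), fun F G A CG hF _ _ hGm hG => ⟨?_, ?_⟩⟩
  · exact (locallyIntegrable_of_abs_le_abs_snd_rpow (by linarith) (by linarith) hGm
      hG).continuous_mul (continuous_of_abs_sub_le_pdist_rpow hα hF)
  intro T hT hT1 x
  have hA : 0 ≤ A := by
    have := (abs_nonneg _).trans (hF (1, 0) (0, 0))
    simpa [pdist] using this
  have hCG : 0 ≤ CG := by
    have := (abs_nonneg _).trans (hG (0, 1) (by simp))
    norm_num at this
    linarith
  obtain ⟨a, ha, ha1, rfl⟩ : ∃ a : ℝ, 0 < a ∧ a ≤ 1 ∧ T = a ^ 4 := by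
    refine ⟨T ^ (1 / 4 : ℝ), by positivity, Real.rpow_le_one hT.le hT1 (by norm_num), ?_⟩
    rw [← Real.rpow_natCast, ← Real.rpow_mul hT.le]
    norm_num
  obtain ⟨ξ, rfl⟩ : ∃ ξ : ℝ × ℝ, x = (a * ξ.1, a ^ 2 * ξ.2) :=
    ⟨(x.1 / a, x.2 / a ^ 2), by ext <;> simp <;> field_simp⟩
  set g := pd1 (pd1 G)
  set x : ℝ × ℝ := (a * ξ.1, a ^ 2 * ξ.2) with hx
  have hab : 0 < a * a ^ 2 := by positivity
  have hscale := integral_comp_prodMap_mul ha (pow_pos ha 2)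
    (fun y : ℝ × ℝ => (a * a ^ 2) * ((F x - F y) * ψ (a ^ 4) (x - y) * g y))
  conv_rhs at hscale => rw [integral_const_mul, smul_eq_mul, inv_mul_cancel_left₀ hab.ne']
  rw [← hscale]
  refine (abs_integral_le_of_abs_le_inv_one_add_sq_mul hM₁ hM₂
    (L := K * CG * A * (a ^ 4) ^ ((2 * α - 2) / 4)) (by positivity) ξ fun w hw => ?_).trans_eq
    (by ring)
  have hxy : x - (a * w.1, a ^ 2 * w.2) = (a * (ξ - w).1, a ^ 2 * (ξ - w).2) := by
    ext <;> simp [hx, mul_sub]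
  have hg' := hG (a * w.1, a ^ 2 * w.2) (by positivity)
  have hF' := hF x (a * w.1, a ^ 2 * w.2)
  rw [pdist_mul_sq ha, Real.mul_rpow ha.le (pdist_nonneg _ _)] at hF'
  have hKw := hK (ξ - w)
  rw [← hφ₁] at hKw
  rw [hxy, hψ.comp_mul ha]
  simp only [abs_mul, abs_of_pos hab, abs_inv]
  have hw' := rpow_mul_weight_le (s := w.2) ha ha1 hα.le
  simp only [Prod.fst_sub, Prod.snd_sub] at hKw
  calc _ = |F x - F (a * w.1, a ^ 2 * w.2)| * |ψ 1 (ξ - w)| * |g (a * w.1, a ^ 2 * w.2)| := by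
        field_simp
    _ ≤ A * (a ^ α * pdist (ξ - w) 0 ^ α) * |ψ 1 (ξ - w)| *
        (CG * (|a ^ 2 * w.2| ^ ((α - 2) / 2) + |a ^ 2 * w.2| ^ ((2 * α - 2) / 2))) := by
        have := pdist_nonneg (ξ - w) 0
        gcongr
    _ = A * CG * (pdist (ξ - w) 0 ^ α * |ψ 1 (ξ - w)|) *
        (a ^ α * (|a ^ 2 * w.2| ^ ((α - 2) / 2) + |a ^ 2 * w.2| ^ ((2 * α - 2) / 2))) := by
        ring
    _ ≤ A * CG * (K * ((1 + (ξ.1 - w.1) ^ 2)⁻¹ * (1 + (ξ.2 - w.2) ^ 2)⁻¹)) *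
        ((a ^ 4) ^ ((2 * α - 2) / 4) *
          (|w.2| ^ ((α - 2) / 2) + |w.2| ^ ((2 * α - 2) / 2))) := by
        gcongr
    _ = _ := by ring
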